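/- arXiv:2409.12316 — 4 statements merged into one kernel-verified Lean document; each statement's English description precedes it below -/
import Mathlib

section
/- Let N > 2 and d ≥ 2, let K be a field, and let the skew-symmetric matrix α be irreducible. Then for any (z₁, v) ∈ Q₁ ∩ A₂ such that z₁ and v are linearly independent over K, the N−2 polynomials q_j, 1 < j < N, viewed as polynomials in the variables (z₂,…,z_{N−1}) ∈ K^{(N−2)d}, are linearly independent over K. -/
open MvPolynomial

/-- The quadratic polynomial `q_j` (for paper index `j+2`, `j : Fin (N-2)`) in the variables
`(z₂, …, z_{N-1})`, indexed by `Fin (N-2) × Fin d`, associated to the skew-symmetric matrix `α`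
and the fixed pair `(z₁, v)`. -/
noncomputable def qPoly {K : Type*} [CommRing K] (N d : ℕ) (α : Matrix (Fin N) (Fin N) K)
    (z1 v : Fin d → K) (j : Fin (N - 2)) : MvPolynomial (Fin (N - 2) × Fin d) K :=
  ∑ k : Fin d,
    X (j, k) *
      (C (α ⟨j.1 + 1, by have := j.2; omega⟩ ⟨0, by have := j.2; omega⟩ * z1 k +
            α ⟨j.1 + 1, by have := j.2; omega⟩ ⟨N - 1, by have := j.2; omega⟩ * v k) +
        ∑ i : Fin (N - 2),
          C (α ⟨j.1 + 1, by have := j.2; omega⟩ ⟨i.1 + 1, by have := i.2; omega⟩ -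
                α ⟨j.1 + 1, by have := j.2; omega⟩ ⟨N - 1, by have := j.2; omega⟩ *
                  α ⟨0, by have := j.2; omega⟩ ⟨i.1 + 1, by have := i.2; omega⟩) *
            X (i, k))

/-- An `N × N` matrix is irreducible: there is no partition of the index set into two
nonempty sets `I`, `J` with `α i j = 0` for all `i ∈ I`, `j ∈ J`. -/
def MatIrreducible {K : Type*} [CommRing K] {N : ℕ} (α : Matrix (Fin N) (Fin N) K) : Prop :=
  ∀ I : Set (Fin N), I.Nonempty → Iᶜ.Nonempty → ∃ i ∈ I, ∃ j ∈ Iᶜ, α i j ≠ 0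

theorem aux_pd1 {K : Type*} [Field K] {n d : ℕ} (a : Fin n → Fin d → K) (B : Fin n → Fin n → K)
    (l j : Fin n) (k0 : Fin d) :
    pderiv (j, k0) (∑ k : Fin d, X (l, k) * (C (a l k) + ∑ i : Fin n, C (B l i) * X (i, k))
        : MvPolynomial (Fin n × Fin d) K) =
      (if l = j then C (a l k0) + ∑ i : Fin n, C (B l i) * X (i, k0) else 0)
        + C (B l j) * X (l, k0) := by
  classical
  have h1 : ∀ (l' : Fin n) (k : Fin d), pderiv (R := K) (j, k0) (X (l', k)) =
      if k = k0 then (if l' = j then 1 else 0) else 0 := by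
    intro l' k
    rw [pderiv_X, Pi.single_apply]
    by_cases h : k = k0 <;> by_cases h' : l' = j <;> simp [h, h', Prod.ext_iff]
  simp only [map_sum, Derivation.leibniz, map_add, pderiv_C, h1, smul_eq_mul, mul_zero, zero_add,
    mul_ite, mul_one, add_zero, Finset.sum_add_distrib, Finset.sum_ite_eq', Finset.mem_univ, if_true]
  have h2 : ∀ x : Fin d, (∑ i : Fin n, if x = k0 then if i = j then (C (B l i) : MvPolynomial (Fin n × Fin d) K) else 0 else 0)
      = if x = k0 then C (B l j) else 0 := by
    intro x
    split_ifs <;> simp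
  simp only [h2, mul_ite, mul_zero, Finset.sum_ite_eq', Finset.mem_univ, if_true]
  ring

theorem aux_lin {K : Type*} [Field K] {n d : ℕ} (a : Fin n → Fin d → K) (B : Fin n → Fin n → K)
    (c : Fin n → K)
    (h : ∑ l, c l • (∑ k : Fin d, X (l, k) * (C (a l k) + ∑ i : Fin n, C (B l i) * X (i, k))
        : MvPolynomial (Fin n × Fin d) K) = 0) (k0 : Fin d) (j : Fin n) :
    c j * a j k0 = 0 ∧ ∀ i, i ≠ j → c j * B j i + c i * B i j = 0 := by
  classical
  have h1 := congrArg (pderiv (j, k0)) h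
  simp only [map_sum, Derivation.map_smul, map_zero] at h1
  simp only [← map_sum, aux_pd1] at h1
  constructor
  · have h2 := congrArg (eval (fun _ => (0 : K))) h1
    simpa [smul_eval, apply_ite] using h2
  · intro i hij
    have h2 := congrArg (eval (fun p : Fin n × Fin d => if p = (i, k0) then (1 : K) else 0)) h1
    have h3 := congrArg (eval (fun _ => (0 : K))) h1
    have h4 : c j * a j k0 = 0 := by simpa [smul_eval, apply_ite] using h3
    simp [smul_eval, apply_ite, mul_add, Finset.sum_add_distrib] at h2
    rw [h4] at h2
    simpa using h2

/-- for an irreducible skew-symmetric matrix `α` with entries in `{-1,0,1}`,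
no zero row and `α_{1N} = 1`, and any `(z₁,v) ∈ Q₁ ∩ A₂` with `z₁, v` linearly independent,
the polynomials `q_j`, `1 < j < N`, are linearly independent over `K`. -/
theorem stmt0 {K : Type*} [Field K] {N d : ℕ} (hN : 2 < N) (hd : 2 ≤ d)
    (α : Matrix (Fin N) (Fin N) K)
    (hskew : ∀ i j, α j i = -α i j)
    (hent : ∀ i j, α i j = -1 ∨ α i j = 0 ∨ α i j = 1)
    (hrow : ∀ i, ∃ j, α i j ≠ 0)
    (h1N : α ⟨0, by omega⟩ ⟨N - 1, by omega⟩ = 1)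
    (hirr : MatIrreducible α)
    (z1 v : Fin d → K)
    (hQ1 : ∑ k : Fin d, z1 k * v k = 0)
    (hz1 : z1 ≠ 0) (hv : v ≠ 0)
    (hli : LinearIndependent K ![z1, v]) :
    LinearIndependent K (fun j : Fin (N - 2) => qPoly N d α z1 v j) := by
  classical
  rw [Fintype.linearIndependent_iff]
  intro c hc
  have key := fun k0 j => aux_lin (n := N - 2) (d := d)
    (fun j k => α ⟨j.1 + 1, by have := j.2; omega⟩ ⟨0, by have := j.2; omega⟩ * z1 k +
            α ⟨j.1 + 1, by have := j.2; omega⟩ ⟨N - 1, by have := j.2; omega⟩ * v k)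
    (fun j i => α ⟨j.1 + 1, by have := j.2; omega⟩ ⟨i.1 + 1, by have := i.2; omega⟩ -
                α ⟨j.1 + 1, by have := j.2; omega⟩ ⟨N - 1, by have := j.2; omega⟩ *
                  α ⟨0, by have := j.2; omega⟩ ⟨i.1 + 1, by have := i.2; omega⟩) c hc k0 j
  rw [LinearIndependent.pair_iff] at hli
  have hz : ∀ j : Fin (N - 2), c j ≠ 0 →
      α ⟨j.1 + 1, by have := j.2; omega⟩ ⟨0, by omega⟩ = 0 ∧
      α ⟨j.1 + 1, by have := j.2; omega⟩ ⟨N - 1, by omega⟩ = 0 := by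
    intro j hj
    apply hli
    funext k
    have := (key k j).1
    simpa [hj] using this
  by_contra hcon
  push Not at hcon
  obtain ⟨j0, hj0⟩ := hcon
  obtain ⟨x, ⟨j, hjx, hj⟩, y, hy, hxy⟩ := hirr
    {x | ∃ j : Fin (N - 2), (⟨j.1 + 1, by have := j.2; omega⟩ : Fin N) = x ∧ c j ≠ 0}
    ⟨_, j0, rfl, hj0⟩ ⟨⟨0, by omega⟩, by
      rintro ⟨j, h, -⟩
      simp at h⟩
  subst hjx
  obtain ⟨hj1, hj2⟩ := hz j hj
  apply hxy
  by_cases hy0 : y.1 = 0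
  · rw [← hj1]; congr 1; exact Fin.ext hy0
  by_cases hyN : y.1 = N - 1
  · rw [← hj2]; congr 1; exact Fin.ext hyN
  have hylt := y.2
  obtain ⟨i, hyi⟩ : ∃ i : Fin (N - 2), (⟨i.1 + 1, by have := i.2; omega⟩ : Fin N) = y :=
    ⟨⟨y.1 - 1, by omega⟩, by apply Fin.ext; simp; omega⟩
  have hci : c i = 0 := by
    by_contra h
    exact hy ⟨i, hyi, h⟩
  have hij : i ≠ j := by
    rintro rfl
    exact hj hci
  have h := (key ⟨0, by omega⟩ j).2 i hij
  rw [← hyi]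
  simpa [hci, hj2, hj] using h
end

section
/- Let N > 3 and d ≥ 2, let K be an infinite field, let the skew-symmetric matrix α be irreducible, and let (z₁, v) ∈ Q₁ ∩ A₂ with z₁ and v linearly independent over K. Then there is a permutation σ of the index set {2,…,N−1} such that, setting Q̃^{(n)} = ∩_{2≤j≤n} Q̃_{σ(j)}(z₁,v) for 2 ≤ n ≤ N−1, the intersection Q̃^{(n+1)} is a proper subset both of Q̃^{(n)} and of Q̃_{σ(n+1)}(z₁,v), for every 2 ≤ n ≤ N−2. -/
open MvPolynomial

/-- The zero set `Q̃_j(z₁,v)` of the polynomial `q_j` in `K^{(N-2)d}`. -/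
def Qtilde {K : Type*} [Field K] (N d : ℕ) (α : Matrix (Fin N) (Fin N) K)
    (z1 v : Fin d → K) (j : Fin (N - 2)) : Set (Fin (N - 2) × Fin d → K) :=
  {w | MvPolynomial.eval w (qPoly N d α z1 v j) = 0}

def EE {K : Type*} [Field K] {n d : ℕ} (a : Fin n → Fin d → K) (β : Fin n → Fin n → K)
    (w : Fin n → Fin d → K) (j : Fin n) : K :=
  w j ⬝ᵥ (a j + ∑ i, β j i • w i)

def PP {K : Type*} [Field K] {n d : ℕ} (a : Fin n → Fin d → K) (β : Fin n → Fin n → K)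
    (j : Fin n) : Prop := ∃ z : Fin d → K, z ⬝ᵥ (a j + β j j • z) ≠ 0

lemma not_PP {K : Type*} [Field K] [Infinite K] {n d : ℕ} (hd : 2 ≤ d) (a : Fin n → Fin d → K)
    (β : Fin n → Fin n → K) (j : Fin n) (h : ¬ PP a β j) : a j = 0 ∧ β j j = 0 := by
  classical
  unfold PP at h
  push Not at h
  have key : ∀ k t, t * (a j k + β j j * t) = 0 := by
    intro k t
    have := h (Pi.single k t)
    simp only [single_dotProduct, Pi.add_apply, Pi.smul_apply, Pi.single_eq_same,
      smul_eq_mul] at this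
    exact this
  have ha : a j = 0 := by
    funext k
    by_contra hk
    obtain ⟨t, ht⟩ := Infinite.exists_notMem_finset ({0, -a j k / β j j} : Finset K)
    simp only [Finset.mem_insert, Finset.mem_singleton, not_or] at ht
    have h1 := (mul_eq_zero.mp (key k t)).resolve_left ht.1
    by_cases hb : β j j = 0
    · simp [hb] at h1; exact hk h1
    · apply ht.2
      field_simp
      linear_combination h1
  refine ⟨ha, ?_⟩
  have := key ⟨0, by omega⟩ 1
  simpa [ha] using this

lemma EE_zero {K : Type*} [Field K] {n d : ℕ} (a : Fin n → Fin d → K) (β : Fin n → Fin n → K)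
    (w : Fin n → Fin d → K) (j : Fin n) (h : w j = 0) : EE a β w j = 0 := by
  simp [EE, h]

lemma EE_three {K : Type*} [Field K] {n d : ℕ} (a : Fin n → Fin d → K) (β : Fin n → Fin n → K)
    (p q r l : Fin n) (x y z : Fin d → K) :
    EE a β (Pi.single p x + Pi.single q y + Pi.single r z) l =
      ((Pi.single p x + Pi.single q y + Pi.single r z : Fin n → Fin d → K) l) ⬝ᵥ
        (a l + (β l p • x + β l q • y + β l r • z)) := by
  have : ∀ p x, ∑ i, β l i • (Pi.single p x : Fin n → Fin d → K) i = β l p • x := by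
    intro p x
    rw [Finset.sum_eq_single p]
    · simp
    · intro b _ hb; simp [hb]
    · simp
  simp only [EE, Pi.add_apply, smul_add, Finset.sum_add_distrib, this]

lemma core {K : Type*} [Field K] [Infinite K] {n d : ℕ} (hd : 2 ≤ d) (a : Fin n → Fin d → K)
    (β : Fin n → Fin n → K) (f : Fin n → ℕ)
    (h2 : ∀ j, ¬ PP a β j → ∀ i, β i j = -β j i)
    (hf : ∀ j, ¬ PP a β j → ∃ k, f k < f j ∧ β j k ≠ 0)
    (h3 : ∀ j m, ¬ PP a β j → ¬ PP a β m → ∃ k, k ≠ j ∧ k ≠ m ∧ (β j k ≠ 0 ∨ β m k ≠ 0)) :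
    ∃ σ : Equiv.Perm (Fin n), ∀ m : Fin n, 1 ≤ m.1 →
      (∃ w, (∀ j : Fin n, j.1 < m.1 → EE a β w (σ j) = 0) ∧ EE a β w (σ m) ≠ 0) ∧
      (∃ w, EE a β w (σ m) = 0 ∧ ∃ j : Fin n, j.1 < m.1 ∧ EE a β w (σ j) ≠ 0) := by
  classical
  have one : ∀ j, PP a β j → ∃ w, (∀ i, i ≠ j → EE a β w i = 0) ∧ EE a β w j ≠ 0 := by
    rintro j ⟨z, hz⟩
    refine ⟨Pi.single j z + Pi.single j 0 + Pi.single j 0, fun i hi => EE_zero _ _ _ _ ?_, ?_⟩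
    · simp [hi]
    · rw [EE_three]; simpa using hz
  have two : ∀ j k, ¬ PP a β j → β j k ≠ 0 →
      ∃ w, (∀ i, i ≠ j → i ≠ k → EE a β w i = 0) ∧ EE a β w j ≠ 0 := by
    intro j k hj hk
    obtain ⟨ha, hb⟩ := not_PP hd a β j hj
    have hkj : k ≠ j := by rintro rfl; exact hk hb
    let e : Fin d → K := Pi.single ⟨0, by omega⟩ 1
    refine ⟨Pi.single j e + Pi.single k e + Pi.single k 0, fun i hi hik => EE_zero _ _ _ _ ?_, ?_⟩
    · simp [hi, hik]
    · rw [EE_three]; simp [hkj.symm, ha, hb, hk, e]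
  let σ := Tuple.sort (fun i => OrderDual.toDual (f i))
  have hσ : ∀ p q : Fin n, f (σ p) < f (σ q) → q.1 < p.1 := by
    intro p q h
    by_contra hpq
    have := Tuple.monotone_sort (fun i => OrderDual.toDual (f i)) (show p ≤ q by
      rw [Fin.le_def]; omega)
    have h' : f (σ q) ≤ f (σ p) := this
    omega
  refine ⟨σ, fun m hm => ⟨?_, ?_⟩⟩
  · by_cases hP : PP a β (σ m)
    · obtain ⟨w, hw, hw'⟩ := one _ hP
      refine ⟨w, fun j hj => hw _ ?_, hw'⟩
      intro h; have := σ.injective h; subst this; omega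
    · obtain ⟨k, hk, hk'⟩ := hf _ hP
      obtain ⟨w, hw, hw'⟩ := two _ k hP hk'
      refine ⟨w, fun j hj => hw _ ?_ ?_, hw'⟩
      · intro h; have := σ.injective h; subst this; omega
      · rintro rfl
        have := hσ _ _ hk
        omega
  · suffices H : ∀ j m, j ≠ m → ∃ w, EE a β w m = 0 ∧ EE a β w j ≠ 0 by
      let o : Fin n := ⟨0, by omega⟩
      have : σ o ≠ σ m := by
        intro h; have := σ.injective h; rw [← this] at hm; simp [o] at hm
      obtain ⟨w, hw, hw'⟩ := H _ _ this
      exact ⟨w, hw, o, by simp [o]; omega, hw'⟩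
    clear hm m
    intro j m hjm
    by_cases hj : PP a β j
    · obtain ⟨w, hw, hw'⟩ := one _ hj
      exact ⟨w, hw _ hjm.symm, hw'⟩
    by_cases hex : ∃ k, k ≠ m ∧ β j k ≠ 0
    · obtain ⟨k, hkm, hk⟩ := hex
      obtain ⟨w, hw, hw'⟩ := two _ _ hj hk
      exact ⟨w, hw _ hjm.symm hkm.symm, hw'⟩
    push Not at hex
    obtain ⟨ha, hb⟩ := not_PP hd a β j hj
    have hβ : β j m ≠ 0 := by
      obtain ⟨k, -, hk⟩ := hf _ hj
      by_cases h : k = m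
      · exact h ▸ hk
      · exact absurd (hex k h) hk
    by_cases hm : PP a β m
    · obtain ⟨z, hz⟩ := hm
      have hz0 : z ≠ 0 := by rintro rfl; simp at hz
      obtain ⟨k, hk⟩ := Function.ne_iff.mp hz0
      simp only [Pi.zero_apply] at hk
      set c := z ⬝ᵥ (a m + β m m • z) with hc
      refine ⟨Pi.single m z + Pi.single j (Pi.single k (c / (β j m * z k))) + Pi.single j 0, ?_, ?_⟩
      · rw [EE_three, h2 j hj m]
        have : z ⬝ᵥ (a m) + β m m * (z ⬝ᵥ z) = c := by
          simp [hc, dotProduct_add, dotProduct_smul]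
        simp [hjm.symm, dotProduct_add, dotProduct_smul]
        field_simp
        linear_combination this
      · rw [EE_three]
        simp [hjm, ha, hb, hk]
        exact ⟨hβ, hz, hβ⟩
    · obtain ⟨k, hkj, hkm, hk⟩ := h3 j m hj hm
      have hk : β m k ≠ 0 := hk.resolve_left (fun h => h (hex k hkm))
      obtain ⟨ha', hb'⟩ := not_PP hd a β m hm
      let e : Fin d → K := Pi.single ⟨0, by omega⟩ 1
      refine ⟨Pi.single j e + Pi.single m e + Pi.single k ((-(β m j) / β m k) • e), ?_, ?_⟩
      · rw [EE_three]
        simp [hjm, hjm.symm, hkj, hkm, hkj.symm, hkm.symm, ha', hb', e]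
        field_simp
        ring
      · rw [EE_three]
        simp [hjm, hjm.symm, hkj, hkm, hkj.symm, hkm.symm, ha, hb, e, hex k hkm, hβ]

lemma rank_exists {K : Type*} [Field K] {N : ℕ} (α : Matrix (Fin N) (Fin N) K)
    (hskew : ∀ i j, α j i = -α i j) (hirr : MatIrreducible α) (o : Fin N) :
    ∃ f : Fin N → ℕ, ∀ j, j ≠ o → ∃ k, f k < f j ∧ α j k ≠ 0 := by
  classical
  let G : SimpleGraph (Fin N) :=
    { Adj := fun i j => i ≠ j ∧ α i j ≠ 0
      symm := ⟨fun i j h => ⟨h.1.symm, by rw [hskew i j]; simpa using h.2⟩⟩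
      loopless := ⟨fun i h => h.1 rfl⟩ }
  have hr : ∀ j, G.Reachable j o := by
    by_contra! hcon
    obtain ⟨j, hj⟩ := hcon
    obtain ⟨x, hx, y, hy, hxy⟩ := hirr {j | G.Reachable j o} ⟨o, SimpleGraph.Reachable.refl _⟩ ⟨j, hj⟩
    apply hy
    have hadj : G.Adj x y := ⟨by rintro rfl; exact hy hx, hxy⟩
    exact hadj.symm.reachable.trans hx
  refine ⟨fun j => G.dist j o, fun j hj => ?_⟩
  obtain ⟨p, hp⟩ := (hr j).exists_walk_length_eq_dist
  cases p with
  | nil => exact absurd rfl hj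
  | @cons _ k _ h p =>
    refine ⟨k, ?_, h.2⟩
    have := SimpleGraph.dist_le p
    simp at hp
    show G.dist k o < G.dist j o
    omega

/-- after a suitable permutation of the indices `{2,…,N-1}`, each partial
intersection `Q̃^{(n+1)} = ⋂_{2 ≤ j ≤ n+1} Q̃_{σ(j)}` is a proper subset of both `Q̃^{(n)}`
and `Q̃_{σ(n+1)}`.  (Our index `m : Fin (N-2)` corresponds to the paper index `m + 2`;
the paper's `n` corresponds to `m + 1`, so the range `2 ≤ n ≤ N-2` becomes `1 ≤ m.1`.) -/
theorem stmt1 {K : Type*} [Field K] [Infinite K] {N d : ℕ} (hN : 3 < N) (hd : 2 ≤ d)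
    (α : Matrix (Fin N) (Fin N) K)
    (hskew : ∀ i j, α j i = -α i j)
    (hent : ∀ i j, α i j = -1 ∨ α i j = 0 ∨ α i j = 1)
    (hrow : ∀ i, ∃ j, α i j ≠ 0)
    (h1N : α ⟨0, by omega⟩ ⟨N - 1, by omega⟩ = 1)
    (hirr : MatIrreducible α)
    (z1 v : Fin d → K)
    (hQ1 : ∑ k : Fin d, z1 k * v k = 0)
    (hz1 : z1 ≠ 0) (hv : v ≠ 0)
    (hli : LinearIndependent K ![z1, v]) :
    ∃ σ : Equiv.Perm (Fin (N - 2)),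
      ∀ m : Fin (N - 2), 1 ≤ m.1 →
        (⋂ (j : Fin (N - 2)) (_ : j.1 < m.1 + 1), Qtilde N d α z1 v (σ j)) ⊂
            (⋂ (j : Fin (N - 2)) (_ : j.1 < m.1), Qtilde N d α z1 v (σ j)) ∧
        (⋂ (j : Fin (N - 2)) (_ : j.1 < m.1 + 1), Qtilde N d α z1 v (σ j)) ⊂
            Qtilde N d α z1 v (σ m) := by
  classical
  let e : Fin (N - 2) → Fin N := fun j => ⟨j.1 + 1, by omega⟩
  let o : Fin N := ⟨0, by omega⟩
  let l : Fin N := ⟨N - 1, by omega⟩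
  have hmid : ∀ x : Fin N, x ≠ o → x ≠ l → ∃ j, x = e j := by
    intro x h1 h2
    have h1' : x.1 ≠ 0 := fun h => h1 (Fin.ext h)
    have h2' : x.1 ≠ N - 1 := fun h => h2 (Fin.ext h)
    exact ⟨⟨x.1 - 1, by omega⟩, Fin.ext (by simp [e]; omega)⟩
  have heo : ∀ j, e j ≠ o := fun j h => by simpa [e, o] using congrArg Fin.val h
  have hel : ∀ j, e j ≠ l := fun j h => by
    have := congrArg Fin.val h
    simp [e, l] at this; omega
  have hei : ∀ i j, e i = e j → i = j := fun i j h => by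
    have := congrArg Fin.val h
    simp [e] at this; exact Fin.ext this
  let a : Fin (N - 2) → Fin d → K := fun j => α (e j) o • z1 + α (e j) l • v
  let β : Fin (N - 2) → Fin (N - 2) → K := fun j i => α (e j) (e i) - α (e j) l * α o (e i)
  have heval : ∀ (w : Fin (N - 2) → Fin d → K) j,
      MvPolynomial.eval (fun p => w p.1 p.2) (qPoly N d α z1 v j) = EE a β w j := by
    intro w j
    simp [qPoly, EE, dotProduct, a, β, Finset.sum_apply, e, o, l]
  have hB : ∀ j, ¬ PP a β j → α (e j) o = 0 ∧ α (e j) l = 0 := by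
    intro j hj
    exact LinearIndependent.pair_iff.mp hli _ _ (not_PP hd a β j hj).1
  have hBr : ∀ j, ¬ PP a β j → ∀ i, β j i = α (e j) (e i) := by
    intro j hj i
    simp [β, (hB j hj).2]
  have hBl : ∀ j, ¬ PP a β j → ∀ i, β i j = α (e i) (e j) := by
    intro j hj i
    simp [β, hskew (e j) o, (hB j hj).1]
  obtain ⟨f, hf⟩ := rank_exists α hskew hirr o
  obtain ⟨σ, hσ⟩ := core hd a β (fun j => f (e j))
    (fun j hj i => by rw [hBr j hj, hBl j hj, hskew])
    (by
      intro j hj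
      obtain ⟨k, hk, hk'⟩ := hf (e j) (heo j)
      obtain ⟨i, rfl⟩ := hmid k (by rintro rfl; exact hk' (hB j hj).1)
        (by rintro rfl; exact hk' (hB j hj).2)
      exact ⟨i, hk, by rwa [hBr j hj]⟩)
    (by
      intro j m hj hm
      obtain ⟨x, hx, y, hy, hxy⟩ := hirr {e j, e m} ⟨e j, by simp⟩
        ⟨o, by simp [(heo j).symm, (heo m).symm]⟩
      simp only [Set.mem_insert_iff, Set.mem_singleton_iff, Set.mem_compl_iff, not_or] at hx hy
      have hyo : y ≠ o := by
        rintro rfl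
        rcases hx with rfl | rfl
        · exact hxy (hB j hj).1
        · exact hxy (hB m hm).1
      have hyl : y ≠ l := by
        rintro rfl
        rcases hx with rfl | rfl
        · exact hxy (hB j hj).2
        · exact hxy (hB m hm).2
      obtain ⟨k, rfl⟩ := hmid y hyo hyl
      refine ⟨k, fun h => hy.1 (by rw [h]), fun h => hy.2 (by rw [h]), ?_⟩
      rw [hBr j hj, hBr m hm]
      rcases hx with rfl | rfl
      · exact Or.inl hxy
      · exact Or.inr hxy)
  refine ⟨σ, fun m hm => ?_⟩
  obtain ⟨⟨w, hw, hw'⟩, ⟨u, hu, j, hj, hu'⟩⟩ := hσ m hm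
  refine ⟨Set.ssubset_iff_subset_ne.mpr ⟨?_, ?_⟩, Set.ssubset_iff_subset_ne.mpr ⟨?_, ?_⟩⟩
  · intro x hx
    simp only [Set.mem_iInter] at hx ⊢
    exact fun j hj => hx j (by omega)
  · intro h
    have h1 : (fun p : Fin (N - 2) × Fin d => w p.1 p.2) ∈
        (⋂ (j : Fin (N - 2)) (_ : j.1 < m.1), Qtilde N d α z1 v (σ j)) := by
      simp only [Set.mem_iInter]
      intro j hj
      exact (heval w _).trans (hw j hj)
    rw [← h] at h1
    simp only [Set.mem_iInter] at h1
    exact hw' ((heval w _).symm.trans (h1 m (by omega)))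
  · intro x hx
    simp only [Set.mem_iInter] at hx
    exact hx m (by omega)
  · intro h
    have h1 : (fun p : Fin (N - 2) × Fin d => u p.1 p.2) ∈ Qtilde N d α z1 v (σ m) :=
      (heval u _).trans hu
    rw [← h] at h1
    simp only [Set.mem_iInter] at h1
    exact hu' ((heval u _).symm.trans (h1 j (by omega)))
end

section
/- Let N > 3 and d ≥ 2, let K be an infinite field, let the skew-symmetric matrix α be irreducible, and let (z₁, v) ∈ Q₁ ∩ A₂ with z₁ and v linearly independent over K. Then for every index 1 < j < N, the intersection ∩_{1<k<N, k≠j} Q̃_k(z₁,v) is not contained in Q̃_j(z₁,v). -/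
open MvPolynomial

def lvl {K ι : Type*} [Field K] (c : ι → ι → K) (T : Set ι) : ℕ → Set ι
  | 0 => T
  | n + 1 => lvl c T n ∪ {j | ∃ k ∈ lvl c T n, c j k ≠ 0}

theorem lvl_mono {K ι : Type*} [Field K] (c : ι → ι → K) (T : Set ι) : Monotone (lvl c T) :=
  monotone_nat_of_le_succ fun _ => Set.subset_union_left

theorem base_exists {K : Type*} [Field K] [Infinite K] {d : ℕ} (hd : 0 < d) (u : Fin d → K) (c : K)
    (h : u ≠ 0 ∨ c ≠ 0) : ∃ x : Fin d → K, x ⬝ᵥ (u + c • x) ≠ 0 := by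
  classical
  obtain ⟨k, hk⟩ : ∃ k, u k ≠ 0 ∨ c ≠ 0 := by
    rcases h with h | h
    · obtain ⟨k, hk⟩ := Function.ne_iff.mp h
      exact ⟨k, Or.inl hk⟩
    · exact ⟨⟨0, hd⟩, Or.inr h⟩
  obtain ⟨t, ht⟩ := Infinite.exists_notMem_finset ({0, -u k / c} : Finset K)
  simp only [Finset.mem_insert, Finset.mem_singleton, not_or] at ht
  refine ⟨Pi.single k t, ?_⟩
  rw [single_dotProduct]
  simp only [Pi.add_apply, Pi.smul_apply, Pi.single_eq_same, smul_eq_mul]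
  refine mul_ne_zero ht.1 fun h0 => ?_
  by_cases hc : c = 0
  · simp [hc] at h0 hk; exact hk h0
  · apply ht.2
    field_simp
    linear_combination h0

theorem abstract_main {K ι : Type*} [Field K] [Infinite K] [Fintype ι] {d : ℕ} (hd : 0 < d)
    (c : ι → ι → K) (u : ι → Fin d → K) (T : Set ι) (hT : ∀ j, j ∈ T ↔ (u j ≠ 0 ∨ c j j ≠ 0))
    (hsk : ∀ j i, j ∉ T → c i j = - c j i)
    (n : ℕ) : ∀ j ∈ lvl c T n, ∃ w : ι → Fin d → K,
      (∀ k, k ≠ j → w k ⬝ᵥ (u k + ∑ i, c k i • w i) = 0) ∧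
      w j ⬝ᵥ (u j + ∑ i, c j i • w i) ≠ 0 ∧
      ∀ k, w k ≠ 0 → k ≠ j → ∃ m < n, k ∈ lvl c T m := by
  classical
  induction n with
  | zero =>
    intro j hj
    obtain ⟨x, hx⟩ := base_exists hd (u j) (c j j) ((hT j).1 hj)
    refine ⟨Pi.single j x, ?_, ?_, ?_⟩
    · intro k hk
      simp [Pi.single_eq_of_ne hk]
    · rw [Finset.sum_eq_single j]
      · simpa using hx
      · intro i _ hi
        simp [Pi.single_eq_of_ne hi]
      · simp
    · intro k hk hkj
      exact absurd (by simp [Pi.single_eq_of_ne hkj]) hk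
  | succ n ih =>
    intro j hj
    by_cases hjn : j ∈ lvl c T n
    · obtain ⟨w, h1, h2, h3⟩ := ih j hjn
      refine ⟨w, h1, h2, fun k hk hkj => ?_⟩
      obtain ⟨m, hm, h⟩ := h3 k hk hkj
      exact ⟨m, by omega, h⟩
    · obtain ⟨j', hj', hc⟩ : ∃ k ∈ lvl c T n, c j k ≠ 0 := by
        rcases hj with hj | hj
        · exact absurd hj hjn
        · exact hj
      obtain ⟨w, h1, h2, h3⟩ := ih j' hj'
      have hjT : j ∉ T := fun h => hjn (lvl_mono c T (Nat.zero_le n) h)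
      have hjj : j ≠ j' := fun h => hjn (h ▸ hj')
      have hwj : w j = 0 := by
        by_contra h
        obtain ⟨m, hm, h⟩ := h3 j h hjj
        exact hjn (lvl_mono c T hm.le h)
      have hu : u j = 0 ∧ c j j = 0 := by
        have := (hT j).not.1 hjT
        push Not at this
        exact this
      have hck : ∀ k, k ≠ j' → w k ≠ 0 → c j k = 0 := by
        intro k hk hwk
        by_contra h
        obtain ⟨m, hm, hkm⟩ := h3 k hwk hk
        exact hjn (lvl_mono c T (Nat.succ_le_of_lt hm) (Or.inr ⟨k, hkm, h⟩))
      have hw' : w j' ≠ 0 := by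
        intro h
        apply h2
        simp [h]
      have hc' : c j' j ≠ 0 := by rw [hsk j j' hjT]; exact neg_ne_zero.2 hc
      set s := w j' ⬝ᵥ (u j' + ∑ i, c j' i • w i) with hs
      obtain ⟨x, hx⟩ : ∃ x : Fin d → K, c j' j * (w j' ⬝ᵥ x) = - s := by
        obtain ⟨a, ha⟩ := Function.ne_iff.mp hw'
        have ha' : w j' a ≠ 0 := ha
        refine ⟨Pi.single a (- s / (c j' j * w j' a)), ?_⟩
        rw [dotProduct_single]
        field_simp
      have hsum : ∀ k, ∑ i, c k i • (Function.update w j x) i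
          = c k j • x + ∑ i, c k i • w i := by
        intro k
        rw [← Finset.add_sum_erase _ _ (Finset.mem_univ j),
          ← Finset.add_sum_erase _ (fun i => c k i • w i) (Finset.mem_univ j)]
        simp only [Function.update_self, hwj, smul_zero, zero_add]
        congr 1
        refine Finset.sum_congr rfl fun i hi => ?_
        rw [Function.update_of_ne (Finset.ne_of_mem_erase hi)]
      refine ⟨Function.update w j x, ?_, ?_, ?_⟩
      · intro k hk
        rw [hsum, Function.update_of_ne hk]
        by_cases hkj : k = j'
        · subst hkj
          rw [add_left_comm, dotProduct_add, dotProduct_smul, smul_eq_mul, hx, ← hs]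
          ring
        · by_cases hwk : w k = 0
          · simp [hwk]
          · rw [hsk j k hjT, hck k hkj hwk]
            simpa using h1 k hkj
      · rw [hsum, Function.update_self, hu.1, hu.2, Finset.sum_eq_single j']
        · simp only [zero_smul, zero_add, dotProduct_smul, smul_eq_mul]
          rw [hsk j j' hjT, dotProduct_comm] at hx
          intro h0
          apply h2
          linear_combination hx + h0
        · intro i _ hi
          by_cases hwi : w i = 0
          · simp [hwi]
          · simp [hck i hi hwi]
        · simp
      · intro k hk hkj
        rw [Function.update_of_ne hkj] at hk
        by_cases hkj' : k = j'
        · exact ⟨n, by omega, hkj' ▸ hj'⟩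
        · obtain ⟨m, hm, h⟩ := h3 k hk hkj'
          exact ⟨m, by omega, h⟩

theorem lvl_all {K ι : Type*} [Field K] (c : ι → ι → K) (T : Set ι)
    (hconn : ∀ I : Set ι, I.Nonempty → (∀ i ∈ I, i ∉ T) → ∃ i ∈ I, ∃ k, k ∉ I ∧ c i k ≠ 0)
    (j : ι) : ∃ n, j ∈ lvl c T n := by
  by_contra hj
  obtain ⟨i, hi, k, hk, hc⟩ := hconn {j | ¬ ∃ n, j ∈ lvl c T n} ⟨j, hj⟩ (fun i hi h => hi ⟨0, h⟩)
  simp only [Set.mem_setOf_eq, not_not] at hk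
  obtain ⟨n, hn⟩ := hk
  exact hi ⟨n + 1, Or.inr ⟨k, hn, hc⟩⟩

/-- for every `1 < j < N`, the intersection of all the other quadrics
`Q̃_k(z₁,v)`, `k ≠ j`, is not contained in `Q̃_j(z₁,v)`. -/
theorem stmt2 {K : Type*} [Field K] [Infinite K] {N d : ℕ} (hN : 3 < N) (hd : 2 ≤ d)
    (α : Matrix (Fin N) (Fin N) K)
    (hskew : ∀ i j, α j i = -α i j)
    (hent : ∀ i j, α i j = -1 ∨ α i j = 0 ∨ α i j = 1)
    (hrow : ∀ i, ∃ j, α i j ≠ 0)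
    (h1N : α ⟨0, by omega⟩ ⟨N - 1, by omega⟩ = 1)
    (hirr : MatIrreducible α)
    (z1 v : Fin d → K)
    (hQ1 : ∑ k : Fin d, z1 k * v k = 0)
    (hz1 : z1 ≠ 0) (hv : v ≠ 0)
    (hli : LinearIndependent K ![z1, v]) :
    ∀ j : Fin (N - 2),
      ¬ (⋂ (k : Fin (N - 2)) (_ : k ≠ j), Qtilde N d α z1 v k) ⊆ Qtilde N d α z1 v j := by
  intro j hsub
  let e : Fin (N - 2) → Fin N := fun i => ⟨i.1 + 1, by have := i.2; omega⟩
  let o : Fin N := ⟨0, by omega⟩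
  let l : Fin N := ⟨N - 1, by omega⟩
  let c : Fin (N - 2) → Fin (N - 2) → K := fun j i => α (e j) (e i) - α (e j) l * α o (e i)
  let u : Fin (N - 2) → Fin d → K := fun j => α (e j) o • z1 + α (e j) l • v
  let T : Set (Fin (N - 2)) := {j | u j ≠ 0 ∨ c j j ≠ 0}
  have hz : ∀ j, j ∉ T → α (e j) o = 0 ∧ α (e j) l = 0 := by
    intro j hj
    have hu : u j = 0 := by
      by_contra h
      exact hj (Or.inl h)
    exact LinearIndependent.pair_iff.1 hli _ _ hu
  have hsk : ∀ j i, j ∉ T → c i j = - c j i := by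
    intro j i hj
    obtain ⟨h1, h2⟩ := hz j hj
    have h3 : α o (e j) = 0 := by rw [hskew, h1, neg_zero]
    simp only [c, h2, h3, hskew (e j) (e i)]
    ring
  have hconn : ∀ I : Set (Fin (N - 2)), I.Nonempty → (∀ i ∈ I, i ∉ T) →
      ∃ i ∈ I, ∃ k, k ∉ I ∧ c i k ≠ 0 := by
    intro I hI hIT
    obtain ⟨a, ⟨i, hi, rfl⟩, b, hb, hab⟩ := hirr (e '' I) (hI.image e)
      ⟨o, by rintro ⟨i, _, hi⟩; simp [e, o, Fin.ext_iff] at hi⟩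
    obtain ⟨h1, h2⟩ := hz i (hIT i hi)
    have hb0 : b.1 ≠ 0 := by
      intro h
      have : b = o := Fin.ext h
      exact hab (this ▸ h1)
    have hbl : b.1 ≠ N - 1 := by
      intro h
      have : b = l := Fin.ext h
      exact hab (this ▸ h2)
    have hbe : e ⟨b.1 - 1, by have := b.2; omega⟩ = b := by
      apply Fin.ext
      simp only [e]
      omega
    refine ⟨i, hi, ⟨b.1 - 1, by have := b.2; omega⟩, fun h => hb ⟨_, h, hbe⟩, ?_⟩
    simp only [c, h2, hbe]
    simpa using hab
  obtain ⟨n, hn⟩ := lvl_all c T hconn j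
  obtain ⟨w, h1, h2, -⟩ := abstract_main (by omega) c u T (fun _ => Iff.rfl) hsk n j hn
  have heval : ∀ k, MvPolynomial.eval (fun p : Fin (N - 2) × Fin d => w p.1 p.2)
      (qPoly N d α z1 v k) = w k ⬝ᵥ (u k + ∑ i, c k i • w i) := by
    intro k
    simp [qPoly, dotProduct, u, c, e, o, l, Finset.sum_apply]
  apply h2
  rw [← heval]
  apply hsub
  simp only [Set.mem_iInter]
  intro k hk
  change MvPolynomial.eval _ _ = 0
  rw [heval]
  exact h1 k hk
end

section
/- Let d ≥ 3 and r > 2d − 1. There exists a constant C_r > 0 such that for every continuous function Φ: ℝ^{2d} → ℝ with ‖Φ‖_{0,r} < ∞, the integral of Φ over Σ₀ against μ^{Σ₀} converges absolutely and | ∫_{Σ₀} Φ dμ^{Σ₀} | ≤ C_r ‖Φ‖_{0,r}. -/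
open MeasureTheory

/-- The resonant quadric `Σ₀ = {z = (z₁,z₂) ∈ ℝ^{2d} : z₁·z₂ = 0}`, where `ℝ^{2d}` is the
Euclidean space with coordinates indexed by `Fin d ⊕ Fin d`. -/
def Sigma0 (d : ℕ) : Set (EuclideanSpace ℝ (Fin d ⊕ Fin d)) :=
  {z | ∑ i : Fin d, z (Sum.inl i) * z (Sum.inr i) = 0}

/-- The measure `μ^{Σ₀}` on `Σ₀`: the `(2d-1)`-dimensional Hausdorff (surface) measure
restricted to `Σ₀`, with density `1/√(|z₁|² + |z₂|²) = 1/‖z‖`. -/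
noncomputable def muSigma0 (d : ℕ) : Measure (EuclideanSpace ℝ (Fin d ⊕ Fin d)) :=
  ((μH[((2 * d - 1 : ℕ) : ℝ)]).restrict (Sigma0 d)).withDensity
    fun z => ENNReal.ofReal (1 / ‖z‖)
open scoped ENNReal NNReal Pointwise

lemma aux_coord {d : ℕ} (a b u v : Fin d → ℝ) (i₀ : Fin d) (ε δ : ℝ) (hε : 0 < ε)
    (h1 : ∑ i, a i * b i = 0) (h2 : ∑ i, u i * v i = 0)
    (ha : ∀ i, |a i| ≤ 2) (hv : ∀ i, |v i| ≤ 2) (hi : ε ≤ |a i₀|)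
    (hau : ∀ i, |a i - u i| ≤ δ) (hbv : ∀ i, i ≠ i₀ → |b i - v i| ≤ δ) :
    |b i₀ - v i₀| ≤ 4 * d / ε * δ := by
  have hδ : 0 ≤ δ := (abs_nonneg _).trans (hau i₀)
  set t : Fin d → ℝ := fun j => a j * b j - u j * v j - (if j = i₀ then a j * (b j - v j) else 0)
    with ht
  have hsum : ∑ j, t j = - (a i₀ * (b i₀ - v i₀)) := by
    simp [ht, Finset.sum_sub_distrib, h1, h2]
  have hb : ∀ j, |t j| ≤ 4 * δ := by
    intro j
    have e2 : |(a j - u j) * v j| ≤ δ * 2 := by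
      rw [abs_mul]; exact mul_le_mul (hau j) (hv j) (abs_nonneg _) hδ
    by_cases hj : j = i₀
    · have : t j = (a j - u j) * v j := by simp only [ht, hj, if_true]; ring
      rw [this]; linarith
    · have : t j = a j * (b j - v j) + (a j - u j) * v j := by
        simp only [ht, hj, if_false]; ring
      have e1 : |a j * (b j - v j)| ≤ 2 * δ := by
        rw [abs_mul]; exact mul_le_mul (ha j) (hbv j hj) (abs_nonneg _) (by norm_num)
      rw [this]
      exact (abs_add_le _ _).trans (by linarith)
  have h3 : |a i₀ * (b i₀ - v i₀)| ≤ d * (4 * δ) := by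
    rw [← abs_neg, ← hsum]
    refine (Finset.abs_sum_le_sum_abs _ _).trans ?_
    refine (Finset.sum_le_sum fun j _ => hb j).trans ?_
    simp
  rw [abs_mul] at h3
  have h4 : ε * |b i₀ - v i₀| ≤ d * (4 * δ) :=
    (mul_le_mul_of_nonneg_right hi (abs_nonneg _)).trans h3
  rw [div_mul_eq_mul_div, le_div_iff₀ hε]
  linarith

lemma coord_le {ι : Type*} [Fintype ι] (z : EuclideanSpace ℝ ι) (j : ι) : |z j| ≤ ‖z‖ := by
  simpa using PiLp.norm_apply_le z j

/-- Piece of the quadric where the coordinate `c` is bounded below. -/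
def piece (d : ℕ) (c : Fin d ⊕ Fin d) : Set (EuclideanSpace ℝ (Fin d ⊕ Fin d)) :=
  {z | z ∈ Sigma0 d ∧ ‖z‖ ≤ 2 ∧ 1 / (2 * (d : ℝ)) ≤ |z c|}

lemma piece_coord (d : ℕ) (hd : 3 ≤ d) (c : Fin d ⊕ Fin d) (z w) (hz : z ∈ piece d c)
    (hw : w ∈ piece d c) (δ : ℝ) (hδ : ∀ j, j ≠ c.swap → |z j - w j| ≤ δ) :
    ∀ j, |z j - w j| ≤ 8 * d ^ 2 * δ := by
  have hd' : (3 : ℝ) ≤ d := by exact_mod_cast hd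
  have hε : (0 : ℝ) < 1 / (2 * d) := by positivity
  have hδ0 : 0 ≤ δ := by
    have : c ≠ c.swap := by cases c <;> simp
    exact (abs_nonneg _).trans (hδ c this)
  have hK : 4 * d / (1 / (2 * d)) * δ = 8 * (d : ℝ) ^ 2 * δ := by field_simp; ring
  obtain ⟨hz1, hz2, hz3⟩ := hz
  obtain ⟨hw1, hw2, hw3⟩ := hw
  have bz := fun j => (coord_le z j).trans hz2
  have bw := fun j => (coord_le w j).trans hw2
  intro j
  by_cases hj : j = c.swap
  · subst hj
    rw [← hK]
    cases c with
    | inl i =>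
      exact aux_coord (fun i => z (.inl i)) (fun i => z (.inr i)) (fun i => w (.inl i))
        (fun i => w (.inr i)) i _ δ hε hz1 hw1 (fun _ => bz _) (fun _ => bw _) hz3
        (fun k => hδ _ (by simp)) (fun k hk => hδ _ (by simpa using hk))
    | inr i =>
      refine aux_coord (fun i => z (.inr i)) (fun i => z (.inl i)) (fun i => w (.inr i))
        (fun i => w (.inl i)) i _ δ hε ?_ ?_ (fun _ => bz _) (fun _ => bw _) hz3
        (fun k => hδ _ (by simp)) (fun k hk => hδ _ (by simpa using hk))
      · simpa [Sigma0, mul_comm] using hz1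
      · simpa [Sigma0, mul_comm] using hw1
  · refine (hδ j hj).trans ?_
    have h1 : 1 ≤ 8 * (d : ℝ) ^ 2 := by nlinarith
    exact le_mul_of_one_le_left hδ0 h1

lemma piece_dist (d : ℕ) (hd : 3 ≤ d) (c : Fin d ⊕ Fin d) (z w) (hz : z ∈ piece d c)
    (hw : w ∈ piece d c) (δ : ℝ) (hδ : ∀ j, j ≠ c.swap → |z j - w j| ≤ δ) :
    dist z w ≤ 16 * d ^ 3 * δ := by
  have hd' : (3 : ℝ) ≤ d := by exact_mod_cast hd
  have h := piece_coord d hd c z w hz hw δ hδ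
  have hδ0 : 0 ≤ δ := by
    have : c ≠ c.swap := by cases c <;> simp
    exact (abs_nonneg _).trans (hδ c this)
  rw [EuclideanSpace.dist_eq, Real.sqrt_le_iff]
  refine ⟨by positivity, ?_⟩
  have : ∀ j ∈ Finset.univ, dist (z j) (w j) ^ 2 ≤ (8 * d ^ 2 * δ) ^ 2 := fun j _ => by
    rw [Real.dist_eq]; exact pow_le_pow_left₀ (abs_nonneg _) (h j) 2
  refine (Finset.sum_le_sum this).trans ?_
  simp only [Finset.sum_const, Finset.card_univ, Fintype.card_sum, Fintype.card_fin, nsmul_eq_mul]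
  push_cast
  have e : (16 * (d : ℝ) ^ 3 * δ) ^ 2 = (2 * d) * (2 * d) * (8 * d ^ 2 * δ) ^ 2 := by ring
  rw [e]
  apply mul_le_mul_of_nonneg_right _ (sq_nonneg _)
  nlinarith

lemma piece_finite (d : ℕ) (hd : 3 ≤ d) (c : Fin d ⊕ Fin d) :
    μH[((2 * d - 1 : ℕ) : ℝ)] (piece d c) < ∞ := by
  classical
  let P : EuclideanSpace ℝ (Fin d ⊕ Fin d) → ({j // j ≠ c.swap} → ℝ) := fun z j => z j
  have : Nonempty (EuclideanSpace ℝ (Fin d ⊕ Fin d)) := ⟨0⟩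
  let g := Function.invFunOn P (piece d c)
  have hcoord : ∀ z w, ∀ j, j ≠ c.swap → |z j - w j| ≤ dist (P z) (P w) := fun z w j hj => by
    simpa [P, Real.dist_eq] using dist_le_pi_dist (P z) (P w) ⟨j, hj⟩
  have hg : ∀ z ∈ piece d c, g (P z) ∈ piece d c ∧ P (g (P z)) = P z := fun z hz =>
    ⟨Function.invFunOn_mem ⟨z, hz, rfl⟩, Function.invFunOn_eq ⟨z, hz, rfl⟩⟩
  have hlip : LipschitzOnWith (16 * d ^ 3 : ℝ≥0) g (P '' piece d c) := by
    apply LipschitzOnWith.of_dist_le_mul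
    rintro _ ⟨z, hz, rfl⟩ _ ⟨w, hw, rfl⟩
    have := piece_dist d hd c _ _ (hg z hz).1 (hg w hw).1 _ (hcoord _ _)
    rw [(hg z hz).2, (hg w hw).2] at this
    simpa using this
  have himg : piece d c ⊆ g '' (P '' piece d c) := by
    intro z hz
    refine ⟨P z, ⟨z, hz, rfl⟩, ?_⟩
    have := piece_dist d hd c _ _ (hg z hz).1 hz _ (hcoord _ _)
    rw [(hg z hz).2, dist_self, mul_zero] at this
    exact dist_le_zero.1 this
  refine (measure_mono himg).trans_lt ((hlip.hausdorffMeasure_image_le (by positivity)).trans_lt ?_)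
  have hcard : Fintype.card {j : Fin d ⊕ Fin d // j ≠ c.swap} = 2 * d - 1 := by
    rw [Fintype.card_subtype_compl]; simp; omega
  rw [← hcard, hausdorffMeasure_pi_real]
  refine ENNReal.mul_lt_top (ENNReal.rpow_lt_top_of_nonneg (by positivity) ENNReal.coe_ne_top) ?_
  have : P '' piece d c ⊆ Metric.closedBall 0 2 := by
    rintro _ ⟨z, hz, rfl⟩
    rw [mem_closedBall_zero_iff, pi_norm_le_iff_of_nonneg (by norm_num)]
    intro j
    exact (coord_le z j).trans hz.2.1
  exact (measure_mono this).trans_lt measure_closedBall_lt_top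

/-- Annulus in the quadric. -/
def ann (d : ℕ) (t : ℝ) : Set (EuclideanSpace ℝ (Fin d ⊕ Fin d)) :=
  {z | z ∈ Sigma0 d ∧ t ≤ ‖z‖ ∧ ‖z‖ ≤ 2 * t}

lemma ann_finite (d : ℕ) (hd : 3 ≤ d) : μH[((2 * d - 1 : ℕ) : ℝ)] (ann d 1) < ∞ := by
  have hd' : (3 : ℝ) ≤ d := by exact_mod_cast hd
  have : ann d 1 ⊆ ⋃ c, piece d c := by
    rintro z ⟨h0, h1, h2⟩
    by_contra hcon
    simp only [Set.mem_iUnion, not_exists] at hcon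
    have hlt : ∀ c, |z c| < 1 / (2 * (d : ℝ)) := fun c => by
      by_contra h
      exact hcon c ⟨h0, by linarith, not_lt.1 h⟩
    have hn : ‖z‖ ^ 2 = ∑ c, |z c| ^ 2 := by
      rw [EuclideanSpace.norm_sq_eq]; rfl
    have : ∑ c, |z c| ^ 2 ≤ ∑ c : Fin d ⊕ Fin d, (1 / (2 * (d : ℝ))) ^ 2 :=
      Finset.sum_le_sum fun c _ => pow_le_pow_left₀ (abs_nonneg _) (hlt c).le 2
    simp only [Finset.sum_const, Finset.card_univ, Fintype.card_sum, Fintype.card_fin,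
      nsmul_eq_mul] at this
    push_cast at this
    have e : ((d : ℝ) + d) * (1 / (2 * d)) ^ 2 = 1 / (2 * d) := by field_simp; ring
    have e2 : 1 / (2 * (d : ℝ)) < 1 := by
      rw [div_lt_one (by positivity)]; linarith
    nlinarith
  refine (measure_mono this).trans_lt ((measure_iUnion_le _).trans_lt ?_)
  rw [tsum_fintype]
  exact ENNReal.sum_lt_top.2 fun c _ => piece_finite d hd c

lemma ann_scale (d : ℕ) (hd : 3 ≤ d) (t : ℝ) (ht : 0 < t) :
    μH[((2 * d - 1 : ℕ) : ℝ)] (ann d t) ≤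
      ENNReal.ofReal (t ^ (2 * d - 1)) * μH[((2 * d - 1 : ℕ) : ℝ)] (ann d 1) := by
  have : ann d t ⊆ t • ann d 1 := by
    rintro z ⟨h0, h1, h2⟩
    refine ⟨t⁻¹ • z, ⟨?_, ?_, ?_⟩, ?_⟩
    · have : ∑ i : Fin d, z (Sum.inl i) * z (Sum.inr i) = 0 := h0
      have e : ∑ i : Fin d, (t⁻¹ • z) (Sum.inl i) * (t⁻¹ • z) (Sum.inr i) =
          t⁻¹ * t⁻¹ * ∑ i : Fin d, z (Sum.inl i) * z (Sum.inr i) := by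
        rw [Finset.mul_sum]
        refine Finset.sum_congr rfl fun i _ => ?_
        simp only [PiLp.smul_apply, smul_eq_mul]; ring
      change ∑ i : Fin d, (t⁻¹ • z) (Sum.inl i) * (t⁻¹ • z) (Sum.inr i) = 0
      rw [e, this, mul_zero]
    · rw [norm_smul, Real.norm_of_nonneg (by positivity), inv_mul_eq_div, le_div_iff₀ ht]
      linarith
    · rw [norm_smul, Real.norm_of_nonneg (by positivity), inv_mul_eq_div, div_le_iff₀ ht]
      linarith
    · simp [smul_smul, ht.ne']
  refine (measure_mono this).trans ?_
  rw [Measure.hausdorffMeasure_smul₀ (by positivity) ht.ne']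
  rw [ENNReal.smul_def, smul_eq_mul, NNReal.rpow_natCast, ENNReal.ofReal_pow ht.le]
  rw [← Real.enorm_of_nonneg ht.le]
  simp [enorm]

/-- Closedness of the quadric. -/
lemma sigma0_closed (d : ℕ) : IsClosed (Sigma0 d) := by
  apply isClosed_eq _ continuous_const
  fun_prop

lemma ann_closed (d : ℕ) (t : ℝ) : IsClosed (ann d t) :=
  (sigma0_closed d).inter ((isClosed_le continuous_const continuous_norm).inter
    (isClosed_le continuous_norm continuous_const))

/-- The integrand. -/
noncomputable def Fr (d : ℕ) (r : ℝ) (z : EuclideanSpace ℝ (Fin d ⊕ Fin d)) : ℝ≥0∞ :=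
  ENNReal.ofReal (1 / ‖z‖) * ENNReal.ofReal ((max 1 ‖z‖) ^ (-r))

lemma ann_int (d : ℕ) (hd : 3 ≤ d) (r : ℝ) (hr : 2 * (d : ℝ) - 1 < r) (t q : ℝ) (ht : 0 < t)
    (h : 1 / t * (max 1 t) ^ (-r) * t ^ (2 * d - 1) ≤ q) :
    ∫⁻ z in ann d t, Fr d r z ∂μH[((2 * d - 1 : ℕ) : ℝ)] ≤
      ENNReal.ofReal q * μH[((2 * d - 1 : ℕ) : ℝ)] (ann d 1) := by
  have hd' : (3 : ℝ) ≤ d := by exact_mod_cast hd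
  have hF : ∀ z ∈ ann d t, Fr d r z ≤ ENNReal.ofReal (1 / t * (max 1 t) ^ (-r)) := by
    rintro z ⟨_, h1, _⟩
    rw [Fr, ← ENNReal.ofReal_mul (by positivity)]
    apply ENNReal.ofReal_le_ofReal
    apply mul_le_mul _ _ (by positivity) (by positivity)
    · exact one_div_le_one_div_of_le ht h1
    · exact Real.rpow_le_rpow_of_nonpos (by positivity) (max_le_max le_rfl h1) (by linarith)
  refine (setLIntegral_mono' (ann_closed d t).measurableSet hF).trans ?_
  rw [setLIntegral_const]
  refine (mul_le_mul_right (ann_scale d hd t ht) _).trans ?_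
  rw [← mul_assoc, ← ENNReal.ofReal_mul (by positivity)]
  exact mul_le_mul_left (ENNReal.ofReal_le_ofReal h) _

lemma total_int (d : ℕ) (hd : 3 ≤ d) (r : ℝ) (hr : 2 * (d : ℝ) - 1 < r) :
    ∫⁻ z in Sigma0 d, Fr d r z ∂μH[((2 * d - 1 : ℕ) : ℝ)] < ∞ := by
  have hd' : (3 : ℝ) ≤ d := by exact_mod_cast hd
  set M := μH[((2 * d - 1 : ℕ) : ℝ)] (ann d 1) with hM
  have hMf : M < ∞ := ann_finite d hd
  have hcov : Sigma0 d ⊆ {0} ∪ ((⋃ n : ℕ, ann d ((1 / 2 : ℝ) ^ (n + 1))) ∪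
      ⋃ n : ℕ, ann d ((2 : ℝ) ^ n)) := by
    intro z hz
    rcases eq_or_ne z 0 with h0 | h0
    · exact Or.inl h0
    right
    rcases le_total ‖z‖ 1 with h1 | h1
    · left
      obtain ⟨n, hn1, hn2⟩ := exists_nat_pow_near_of_lt_one (norm_pos_iff.2 h0) h1
        (by norm_num : (0 : ℝ) < 1 / 2) (by norm_num)
      refine Set.mem_iUnion.2 ⟨n, hz, hn1.le, hn2.trans (le_of_eq ?_)⟩
      rw [pow_succ]; ring
    · right
      obtain ⟨n, hn1, hn2⟩ := exists_nat_pow_near h1 (by norm_num : (1 : ℝ) < 2)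
      refine Set.mem_iUnion.2 ⟨n, hz, hn1, hn2.le.trans (le_of_eq ?_)⟩
      rw [pow_succ]; ring
  have hgeom : ∑' n : ℕ, ENNReal.ofReal ((1 / 2 : ℝ) ^ n) * M < ∞ := by
    rw [ENNReal.tsum_mul_right]
    refine ENNReal.mul_lt_top ?_ hMf
    rw [← ENNReal.ofReal_tsum_of_nonneg (fun n => by positivity) summable_geometric_two]
    exact ENNReal.ofReal_lt_top
  refine (lintegral_mono_set hcov).trans_lt ((lintegral_union_le _ _ _).trans_lt ?_)
  refine ENNReal.add_lt_top.2 ⟨?_, (lintegral_union_le _ _ _).trans_lt (ENNReal.add_lt_top.2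
    ⟨(lintegral_iUnion_le _ _).trans_lt ((ENNReal.tsum_le_tsum fun n => ?_).trans_lt hgeom),
     (lintegral_iUnion_le _ _).trans_lt ((ENNReal.tsum_le_tsum fun n => ?_).trans_lt hgeom)⟩)⟩
  · have : ∫⁻ z in ({0} : Set (EuclideanSpace ℝ (Fin d ⊕ Fin d))), Fr d r z
        ∂μH[((2 * d - 1 : ℕ) : ℝ)] ≤ ∫⁻ z in ({0} : Set (EuclideanSpace ℝ (Fin d ⊕ Fin d))), 0
        ∂μH[((2 * d - 1 : ℕ) : ℝ)] := by
      apply setLIntegral_mono' (measurableSet_singleton _)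
      rintro z rfl
      simp [Fr]
    exact this.trans_lt (by simp)
  · apply ann_int d hd r hr _ _ (by positivity)
    have hle : (1 / 2 : ℝ) ^ (n + 1) ≤ 1 := pow_le_one₀ (by norm_num) (by norm_num)
    rw [max_eq_left hle, Real.one_rpow]
    set t := (1 / 2 : ℝ) ^ (n + 1) with htt
    have ht : 0 < t := by positivity
    have e : 2 * d - 1 = (2 * d - 3) + 1 + 1 := by omega
    rw [e, pow_succ, pow_succ]
    have : 1 / t * 1 * (t ^ (2 * d - 3) * t * t) = t ^ (2 * d - 3) * t := by field_simp
    rw [this]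
    have h1 : t ^ (2 * d - 3) ≤ 1 := pow_le_one₀ ht.le hle
    have h2 : t ≤ (1 / 2 : ℝ) ^ n := pow_le_pow_of_le_one (by norm_num) (by norm_num) (by omega)
    nlinarith
  · apply ann_int d hd r hr _ _ (by positivity)
    have hle : 1 ≤ (2 : ℝ) ^ n := one_le_pow₀ (by norm_num)
    rw [max_eq_right hle]
    have h12 : (1 / 2 : ℝ) ^ n = ((2 : ℝ) ^ n) ^ (-1 : ℝ) := by
      rw [Real.rpow_neg_one, one_div, inv_pow]
    rw [h12]
    set t := (2 : ℝ) ^ n with htt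
    have ht : 0 < t := by positivity
    rw [one_div, ← Real.rpow_neg_one, ← Real.rpow_natCast t (2 * d - 1), ← Real.rpow_add ht,
      ← Real.rpow_add ht]
    apply Real.rpow_le_rpow_of_exponent_le hle
    have : ((2 * d - 1 : ℕ) : ℝ) = 2 * d - 1 := by
      rw [Nat.cast_sub (by omega)]; push_cast; ring
    rw [this]; linarith

lemma cont_wt (d : ℕ) (r : ℝ) :
    Continuous fun z : EuclideanSpace ℝ (Fin d ⊕ Fin d) => (max 1 ‖z‖) ^ (-r) := by
  refine Continuous.rpow_const (by fun_prop) fun z => Or.inl ?_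
  positivity

lemma int_wt (d : ℕ) (hd : 3 ≤ d) (r : ℝ) (hr : 2 * (d : ℝ) - 1 < r) :
    Integrable (fun z : EuclideanSpace ℝ (Fin d ⊕ Fin d) => (max 1 ‖z‖) ^ (-r)) (muSigma0 d) := by
  refine ⟨(cont_wt d r).aestronglyMeasurable, ?_⟩
  rw [hasFiniteIntegral_iff_ofReal (Filter.Eventually.of_forall fun z => by positivity)]
  rw [muSigma0, lintegral_withDensity_eq_lintegral_mul _ (by fun_prop)
    (cont_wt d r).measurable.ennreal_ofReal]
  exact total_int d hd r hr

/-- for `d ≥ 3` and `r > 2d − 1` there is a constant `C_r > 0` such that every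
continuous `Φ` with `|Φ(z)| ⟨z⟩^r ≤ B` is absolutely integrable against `μ^{Σ₀}` and
`|∫_{Σ₀} Φ dμ^{Σ₀}| ≤ C_r B`. -/
theorem stmt8 (d : ℕ) (hd : 3 ≤ d) (r : ℝ) (hr : 2 * (d : ℝ) - 1 < r) :
    ∃ C : ℝ, 0 < C ∧
      ∀ Φ : EuclideanSpace ℝ (Fin d ⊕ Fin d) → ℝ, Continuous Φ →
        ∀ B : ℝ, (∀ z, |Φ z| * (max 1 ‖z‖) ^ r ≤ B) →
          Integrable Φ (muSigma0 d) ∧ |∫ z, Φ z ∂(muSigma0 d)| ≤ C * B := by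
  have hI := int_wt d hd r hr
  have h0 : 0 ≤ ∫ z, (max 1 ‖z‖) ^ (-r) ∂(muSigma0 d) := integral_nonneg fun z => by positivity
  refine ⟨(∫ z, (max 1 ‖z‖) ^ (-r) ∂(muSigma0 d)) + 1, by linarith, fun Φ hΦ B hB => ?_⟩
  have hB0 : 0 ≤ B := le_trans (by positivity) (hB 0)
  have hle : ∀ z, ‖Φ z‖ ≤ B * (max 1 ‖z‖) ^ (-r) := fun z => by
    rw [Real.rpow_neg (by positivity), ← div_eq_mul_inv, le_div_iff₀ (by positivity)]
    exact hB z
  have hg := hI.const_mul B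
  refine ⟨hg.mono' hΦ.aestronglyMeasurable (Filter.Eventually.of_forall hle), ?_⟩
  have := norm_integral_le_of_norm_le hg (Filter.Eventually.of_forall hle)
  rw [integral_const_mul, Real.norm_eq_abs] at this
  linarith
end
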